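/- For every n ≥ 2, any (1,2,n;2)-LRM Gray code has at most 2n codewords. That is, if v_0, v_1, …, v_{M-1} is a cyclic sequence of pairwise distinct binary words of length n, each of Hamming weight 2, such that for every k (indices of codewords taken modulo M) the word v_{k+1} is obtained from v_k by choosing a position i (positions taken modulo n) with (v_k)_i = 0 and (v_k)_{i+1} = 1 and setting (v_{k+1})_i = 1, (v_{k+1})_{i+1} = 0, with v_{k+1} agreeing with v_k in all other positions, then M ≤ 2n. -/

import Mathlib

/-- Any `(1,2,n;2)`-LRM Gray code has at most `2n` codewords: if
`v : ZMod M → (ZMod n → Fin 2)` is a cyclic sequence of pairwise distinct binary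
words of length `n`, each of Hamming weight `2`, such that each codeword is obtained
from its predecessor by replacing the pattern `(0,1)` at some pair of cyclically
adjacent positions `(i, i+1)` by `(1,0)` and leaving all other bits unchanged,
then `M ≤ 2 * n`. -/
theorem lrm_gray_code_size_le (n M : ℕ) (hn : 2 ≤ n) (hM : 0 < M)
    (v : ZMod M → (ZMod n → Fin 2))
    (hdistinct : Function.Injective v)
    (hweight : ∀ k : ZMod M, Nat.card {i : ZMod n // v k i = 1} = 2)
    (hstep : ∀ k : ZMod M, ∃ i : ZMod n,
      v k i = 0 ∧ v k (i + 1) = 1 ∧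
      v (k + 1) i = 1 ∧ v (k + 1) (i + 1) = 0 ∧
      ∀ j : ZMod n, j ≠ i → j ≠ i + 1 → v (k + 1) j = v k j) :
    M ≤ 2 * n := by
  have : NeZero n := ⟨by omega⟩
  let P : ℕ → ℤ × ℤ → Prop := fun t p => p.1 < p.2 ∧ p.2 < p.1 + n ∧
    ∀ i : ZMod n, v (t : ZMod M) i = 1 ↔ (i = (p.1 : ZMod n) ∨ i = (p.2 : ZMod n))
  have hne : ∀ a b : ℤ, a < b → b < a + n → (a : ZMod n) ≠ (b : ZMod n) := by
    intro a b h1 h2 h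
    rw [ZMod.intCast_eq_intCast_iff_dvd_sub] at h
    have := Int.le_of_dvd (by omega) h
    omega
  have h0 : ∃ p, P 0 p := by
    have h := hweight ((0 : ℕ) : ZMod M)
    have h' : Set.ncard {i : ZMod n | v ((0 : ℕ) : ZMod M) i = 1} = 2 := h
    obtain ⟨a, b, hab, hs⟩ := Set.ncard_eq_two.mp h'
    have hs' : ∀ i, v ((0 : ℕ) : ZMod M) i = 1 ↔ (i = a ∨ i = b) := by
      intro i
      have := Set.ext_iff.mp hs i
      simpa using this
    have ha := ZMod.val_lt a
    have hb := ZMod.val_lt b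
    have hval : a.val ≠ b.val := fun h => hab (ZMod.val_injective n h)
    rcases lt_or_gt_of_ne hval with hlt | hlt
    · refine ⟨((a.val : ℤ), (b.val : ℤ)), ?_, ?_, ?_⟩
      · exact Int.ofNat_lt.mpr hlt
      · show (b.val : ℤ) < a.val + n
        omega
      · intro i
        rw [hs' i]
        simp
    · refine ⟨((b.val : ℤ), (a.val : ℤ)), ?_, ?_, ?_⟩
      · exact Int.ofNat_lt.mpr hlt
      · show (a.val : ℤ) < b.val + n
        omega
      · intro i
        rw [hs' i]
        simp [or_comm]
  have hs : ∀ t p, P t p → ∃ q, P (t + 1) q ∧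
      ((q.1 = p.1 - 1 ∧ q.2 = p.2) ∨ (q.1 = p.1 ∧ q.2 = p.2 - 1)) := by
    rintro t ⟨x, y⟩ ⟨hxy, hyx, hP⟩
    simp only at hxy hyx hP
    obtain ⟨i, h1, h2, h3, h4, h5⟩ := hstep (t : ZMod M)
    have hcast : ((t + 1 : ℕ) : ZMod M) = (t : ZMod M) + 1 := by push_cast; rfl
    have hi : ¬ (i = (x : ZMod n) ∨ i = (y : ZMod n)) := by
      rw [← hP, h1]; decide
    push Not at hi
    have hii : i ≠ i + 1 := by
      intro h; rw [← h, h1] at h2; exact absurd h2 (by decide)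
    have hxy' := hne x y hxy hyx
    rcases (hP _).mp h2 with h | h
    · have hix : i = ((x - 1 : ℤ) : ZMod n) := by
        push_cast; rw [← h]; ring
      refine ⟨(x - 1, y), ⟨by simp only; omega, ?_, ?_⟩, Or.inl ⟨rfl, rfl⟩⟩
      · show y < x - 1 + n
        have : y ≠ x - 1 + n := by
          intro hy
          apply hi.2
          rw [hix, hy]; push_cast; simp
        omega
      · intro j
        show v ((t + 1 : ℕ) : ZMod M) j = 1 ↔ (j = ((x - 1 : ℤ) : ZMod n) ∨ j = (y : ZMod n))
        rw [hcast, ← hix]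
        by_cases hj : j = i
        · subst hj; simp [h3]
        by_cases hj' : j = i + 1
        · subst hj'
          rw [h4]
          simp only [h] at *
          simp [hj, hxy']
        · rw [h5 j hj hj', hP j, ← h]
          simp [hj, hj']
    · have hix : i = ((y - 1 : ℤ) : ZMod n) := by
        push_cast; rw [← h]; ring
      refine ⟨(x, y - 1), ⟨?_, ?_, ?_⟩, Or.inr ⟨rfl, rfl⟩⟩
      · show x < y - 1
        have : x ≠ y - 1 := by
          intro hy
          apply hi.1
          rw [hix, hy]
        omega
      · show y - 1 < x + n
        omega
      · intro j
        show v ((t + 1 : ℕ) : ZMod M) j = 1 ↔ (j = (x : ZMod n) ∨ j = ((y - 1 : ℤ) : ZMod n))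
        rw [hcast, ← hix]
        by_cases hj : j = i
        · subst hj; simp [h3]
        by_cases hj' : j = i + 1
        · subst hj'
          rw [h4]
          simp only [h] at *
          simp [hj, hxy'.symm]
        · rw [h5 j hj hj', hP j, ← h]
          simp [hj, hj']
  obtain ⟨p0, hp0⟩ := h0
  choose! g hg using hs
  let f : ℕ → ℤ × ℤ := fun t => Nat.rec p0 (fun t p => g t p) t
  have hf : ∀ t, P t (f t) := by
    intro t
    induction t with
    | zero => exact hp0
    | succ t ih => exact (hg t _ ih).1
  have hR : ∀ t, ((f (t + 1)).1 = (f t).1 - 1 ∧ (f (t + 1)).2 = (f t).2) ∨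
      ((f (t + 1)).1 = (f t).1 ∧ (f (t + 1)).2 = (f t).2 - 1) :=
    fun t => (hg t _ (hf t)).2
  clear_value f
  have hsum : ∀ t m : ℕ, (f (t + m)).1 + (f (t + m)).2 = (f t).1 + (f t).2 - m := by
    intro t m
    induction m with
    | zero => simp
    | succ m ih =>
      have := hR (t + m)
      rw [← add_assoc]
      push_cast
      omega
  by_contra hlt
  have hneq : ∀ t, (f (t + 2 * n)).2 - (f (t + 2 * n)).1 ≠ (f t).2 - (f t).1 := by
    intro t heq
    have hs := hsum t (2 * n)
    push_cast at hs
    have e1 : (f (t + 2 * n)).1 = (f t).1 - n := by omega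
    have e2 : (f (t + 2 * n)).2 = (f t).2 - n := by omega
    have hv : v ((t + 2 * n : ℕ) : ZMod M) = v (t : ZMod M) := by
      funext i
      have a1 := (hf (t + 2 * n)).2.2 i
      have a2 := (hf t).2.2 i
      rw [e1, e2] at a1
      push_cast at a1
      simp only [CharP.cast_eq_zero, sub_zero] at a1
      rw [← a2] at a1
      push_cast
      generalize v ((t : ZMod M) + 2 * (n : ZMod M)) i = a at a1
      generalize v (t : ZMod M) i = b at a1
      revert a b
      decide
    have h := hdistinct hv
    have h2 : ((2 * n : ℕ) : ZMod M) = 0 := by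
      rw [Nat.cast_add] at h
      simpa using h
    rw [ZMod.natCast_eq_zero_iff] at h2
    exact hlt (Nat.le_of_dvd (by omega) h2)
  let d : ℕ → ℤ := fun t => (f t).2 - (f t).1
  have hd : ∀ t, 0 < d t ∧ d t < n := by
    intro t
    obtain ⟨h1, h2, -⟩ := hf t
    simp only [d]
    omega
  have hsign : ∀ t, (0 < d (t + 2 * n) - d t ↔ 0 < d 0 - d 0 + (d (0 + 2 * n) - d 0)) := by
    intro t
    induction t with
    | zero => simp
    | succ t ih =>
      rw [← ih]
      have a1 := hR t
      have a2 := hR (t + 2 * n)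
      have a3 := hsum t (2 * n)
      have a4 := hneq t
      have a5 := hneq (t + 1)
      have e : t + 1 + 2 * n = t + 2 * n + 1 := by omega
      rw [e] at a5 ⊢
      push_cast at a3
      simp only [d]
      omega
  have hbd := hd 0
  by_cases hpos : 0 < d 0 - d 0 + (d (0 + 2 * n) - d 0)
  · have : ∀ k : ℕ, d 0 + k ≤ d (k * (2 * n)) := by
      intro k
      induction k with
      | zero => simp
      | succ k ih =>
        have := (hsign (k * (2 * n))).mpr hpos
        rw [Nat.succ_mul]
        push_cast
        omega
    have h1 := this n
    have h2 := hd (n * (2 * n))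
    omega
  · have : ∀ k : ℕ, d (k * (2 * n)) ≤ d 0 - k := by
      intro k
      induction k with
      | zero => simp
      | succ k ih =>
        have h1 := mt (hsign (k * (2 * n))).mp hpos
        have h2 : d (k * (2 * n) + 2 * n) ≠ d (k * (2 * n)) := hneq (k * (2 * n))
        rw [Nat.succ_mul]
        push_cast
        omega
    have h1 := this n
    have h2 := hd (n * (2 * n))
    omega
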